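/- Let Ω ∈ K^{n×ℓ} be a Gaussian embedding, and let A ∈ K^{n×d} and B ∈ K^{n×p} be matrices with r := rank(A) < ℓ − α_K. Then the sketch-and-solve solution X̂ = (Ω*A)⁺(Ω*B) satisfies E‖B − AX̂‖_F² = (1 + r/(ℓ − r − α_K)) · min_{X ∈ K^{d×p}} ‖B − AX‖_F². -/

import Mathlib

open MeasureTheory ProbabilityTheory Matrix Filter
open scoped ENNReal Topology ComplexOrder

noncomputable section

open Classical in
/-- `α_K`: 1 if `K = ℝ`, 0 if `K = ℂ`. -/
def alphaK (K : Type*) [RCLike K] : ℝ := if (RCLike.I : K) = 0 then 1 else 0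

/-- Squared Frobenius norm of a matrix. -/
def frobSq {K : Type*} [RCLike K] {m n : Type*} [Fintype m] [Fintype n]
    (A : Matrix m n K) : ℝ := ∑ i, ∑ j, ‖A i j‖ ^ 2

/-- The four Penrose conditions characterizing the Moore–Penrose pseudoinverse. -/
def IsMoorePenrose {K : Type*} [RCLike K] {m n : Type*} [Fintype m] [Fintype n]
    (A : Matrix m n K) (X : Matrix n m K) : Prop :=
  A * X * A = A ∧ X * A * X = X ∧ (A * X)ᴴ = A * X ∧ (X * A)ᴴ = X * A

instance matrixMeasurableSpace {m n α : Type*} [MeasurableSpace α] :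
    MeasurableSpace (Matrix m n α) :=
  inferInstanceAs (MeasurableSpace (m → n → α))

/-- `M` is rotation-invariant: `U * M` has the same distribution as `M` for every unitary `U`. -/
def RotationInvariant {K : Type*} [RCLike K] [MeasurableSpace K]
    {Y : Type*} [MeasurableSpace Y] (μ : Measure Y) {n ℓ : ℕ}
    (M : Y → Matrix (Fin n) (Fin ℓ) K) : Prop :=
  ∀ U : Matrix (Fin n) (Fin n) K, U ∈ Matrix.unitaryGroup (Fin n) K →
    Measure.map (fun ω => U * M ω) μ = Measure.map M μ

/-- `M` is a random orthonormal embedding: rotation-invariant, with orthonormal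
columns almost surely. -/
def IsRandomOrthonormal {K : Type*} [RCLike K] [MeasurableSpace K]
    {Y : Type*} [MeasurableSpace Y] (μ : Measure Y) {n ℓ : ℕ}
    (M : Y → Matrix (Fin n) (Fin ℓ) K) : Prop :=
  Measurable M ∧ RotationInvariant μ M ∧ ∀ᵐ ω ∂μ, (M ω)ᴴ * M ω = 1

open Classical in
/-- A standard normal sample in `K` built from two independent real coordinates:
for `K = ℝ` it is the first coordinate, for `K = ℂ` it is `(g₁ + i g₂)/√2`. -/
def stdGaussianEntry (K : Type*) [RCLike K] (v : Bool → ℝ) : K :=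
  if (RCLike.I : K) = 0 then (v false : K)
  else ((v false : K) + RCLike.I * (v true : K)) / (Real.sqrt 2 : K)

/-- The distribution of an `r × c` matrix with independent standard normal
`N_K(0,1)` entries. -/
def gaussianMatrix (K : Type*) [RCLike K] [MeasurableSpace K] (r c : ℕ) :
    Measure (Matrix (Fin r) (Fin c) K) :=
  Measure.map
    (fun g : Fin r → Fin c → Bool → ℝ => Matrix.of fun i j => stdGaussianEntry K (g i j))
    (Measure.pi fun _ : Fin r => Measure.pi fun _ : Fin c =>
      Measure.pi fun _ : Bool => gaussianReal 0 1)

/-- `M` is a Gaussian embedding: a random matrix with iid standard normal `N_K(0,1)` entries. -/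
def IsGaussianEmbedding {K : Type*} [RCLike K] [MeasurableSpace K]
    {Y : Type*} [MeasurableSpace Y] (μ : Measure Y) {n ℓ : ℕ}
    (M : Y → Matrix (Fin n) (Fin ℓ) K) : Prop :=
  Measurable M ∧ Measure.map M μ = gaussianMatrix K n ℓ


section SketchProof

/-- law of a single entry -/
def gammaK (K : Type*) [RCLike K] [MeasurableSpace K] : Measure K :=
  Measure.map (stdGaussianEntry K) (Measure.pi fun _ : Bool => gaussianReal 0 1)

lemma I_sq_or {K : Type*} [RCLike K] : (RCLike.I : K) = 0 ∨ (RCLike.I : K) * RCLike.I = -1 := by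
  exact RCLike.I_mul_I

lemma alphaK_zero {K : Type*} [RCLike K] (h : (RCLike.I : K) = 0) : alphaK K = 1 := by
  simp [alphaK, h]

lemma alphaK_one {K : Type*} [RCLike K] (h : (RCLike.I : K) ≠ 0) : alphaK K = 0 := by
  simp [alphaK, h]

lemma I_ne_norm {K : Type*} [RCLike K] (h : (RCLike.I : K) ≠ 0) : RCLike.im (RCLike.I : K) = 1 := by
  have h3 := RCLike.I_im (RCLike.I : K)
  have h4 : RCLike.im (RCLike.I : K) ≠ 0 := by
    intro h5
    apply h
    apply RCLike.ext <;> simp [h5]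
  exact mul_left_cancel₀ h4 (by rw [h3, mul_one])

/-- the entry map as a real continuous linear map -/
def entryCLM (K : Type*) [RCLike K] : (Bool → ℝ) →L[ℝ] K :=
  LinearMap.toContinuousLinearMap
    { toFun := stdGaussianEntry K
      map_add' := by
        intro x y
        by_cases h : (RCLike.I : K) = 0
        · simp [stdGaussianEntry, h]
        · simp [stdGaussianEntry, h]; ring
      map_smul' := by
        intro c x
        by_cases h : (RCLike.I : K) = 0
        · simp [stdGaussianEntry, h, RCLike.real_smul_eq_coe_mul]
        · simp [stdGaussianEntry, h, RCLike.real_smul_eq_coe_mul]; ring }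

lemma entryCLM_coe (K : Type*) [RCLike K] : ⇑(entryCLM K) = stdGaussianEntry K := rfl

lemma measurable_entry (K : Type*) [RCLike K] [MeasurableSpace K] [BorelSpace K] :
    Measurable (stdGaussianEntry K) := by
  rw [← entryCLM_coe]; exact (entryCLM K).continuous.measurable

instance gammaK_prob (K : Type*) [RCLike K] [MeasurableSpace K] [BorelSpace K] :
    IsProbabilityMeasure (gammaK K) :=
  Measure.isProbabilityMeasure_map (measurable_entry K).aemeasurable

lemma gaussianMatrix_eq (K : Type*) [RCLike K] [MeasurableSpace K] [BorelSpace K] (r c : ℕ) :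
    gaussianMatrix K r c =
      (Measure.pi fun _ : Fin r => Measure.pi fun _ : Fin c => gammaK K : Measure (Fin r → Fin c → K)) := by
  unfold gaussianMatrix gammaK
  have h1 : (Measure.pi fun _ : Fin c => Measure.map (stdGaussianEntry K)
      (Measure.pi fun _ : Bool => gaussianReal 0 1)) =
      Measure.map (fun (g : Fin c → Bool → ℝ) j => stdGaussianEntry K (g j))
        (Measure.pi fun _ : Fin c => Measure.pi fun _ : Bool => gaussianReal 0 1) := by
    rw [Measure.pi_map_pi (hμ := fun _ => ?_) (fun _ => (measurable_entry K).aemeasurable)]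
    have := gammaK_prob K
    unfold gammaK at this
    infer_instance
  rw [h1, ← Measure.pi_map_pi (hμ := fun _ => ?_) (fun _ => ?_)]
  · rfl
  · have := gammaK_prob K
    unfold gammaK at this
    rw [← h1]
    infer_instance
  · exact (measurable_pi_lambda _ fun j => (measurable_entry K).comp (measurable_pi_apply j)).aemeasurable

/-- complex coefficient of a real functional on `K` -/
def aC {K : Type*} [RCLike K] (L : K →L[ℝ] ℝ) : K := (L 1 : K) - RCLike.I * (L RCLike.I : K)

lemma L_eq {K : Type*} [RCLike K] (L : K →L[ℝ] ℝ) (z : K) : L z = RCLike.re (aC L * z) := by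
  have h : z = (RCLike.re z : ℝ) • (1 : K) + (RCLike.im z : ℝ) • (RCLike.I : K) := by
    rw [RCLike.real_smul_eq_coe_mul, RCLike.real_smul_eq_coe_mul, mul_one, RCLike.re_add_im]
  have h2 : L z = RCLike.re z * L 1 + RCLike.im z * L RCLike.I := by
    conv_lhs => rw [h]
    rw [map_add, map_smul, map_smul]; simp
  rw [h2, aC]
  by_cases hI : (RCLike.I : K) = 0
  · simp [hI]; ring
  · have := I_ne_norm hI
    simp [RCLike.mul_re, this]; ring

lemma aC_mul {K : Type*} [RCLike K] (L L' : K →L[ℝ] ℝ) (q : K) (h : ∀ z, L' z = L (q * z)) :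
    aC L' = q * aC L := by
  rw [aC, h, h, L_eq L, L_eq L, mul_one]
  by_cases hI : (RCLike.I : K) = 0
  · simp only [hI, zero_mul, sub_zero]
    have : ∀ z : K, (RCLike.re z : K) = z := fun z => by
      conv_rhs => rw [← RCLike.re_add_im z]
      simp [hI]
    rw [this, mul_comm]
  · have h1 := I_ne_norm hI
    rw [mul_comm q (aC L), ← mul_assoc]
    generalize aC L * q = w
    apply RCLike.ext <;> simp [RCLike.mul_re, RCLike.mul_im, h1]

lemma charFun_gamma (K : Type*) [RCLike K] [MeasurableSpace K] [BorelSpace K] (L : K →L[ℝ] ℝ) :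
    charFunDual (gammaK K) L = ((Real.exp (-((1 + alphaK K) / 4) * ‖aC L‖ ^ 2) : ℝ) : ℂ) := by
  have h0 : gammaK K = Measure.map (entryCLM K) (Measure.pi fun _ : Bool => gaussianReal 0 1) := rfl
  have hb : ∀ M : StrongDual ℝ ℝ, charFunDual (gaussianReal 0 1) M =
      ((Real.exp (-(M 1)^2/2) : ℝ) : ℂ) := by
    intro M
    rw [charFunDual_eq_charFun_map_one, gaussianReal_map_continuousLinearMap, charFun_gaussianReal]
    push_cast
    simp only [Real.coe_toNNReal _ (sq_nonneg (M 1)), map_zero]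
    simp
    ring_nf
  rw [h0, charFunDual_map, charFunDual_pi]
  simp only [hb, Fintype.univ_bool, Finset.prod_pair (show true ≠ false by decide)]
  rw [← Complex.ofReal_mul, ← Real.exp_add]
  congr 2
  simp only [ContinuousLinearMap.comp_apply, ContinuousLinearMap.single_apply, entryCLM_coe]
  by_cases hI : (RCLike.I : K) = 0
  · have hn : ‖aC L‖^2 = (L 1)^2 := by simp [aC, hI]
    rw [hn, alphaK_zero hI]
    simp [stdGaussianEntry, hI]; ring
  · have h1 := I_ne_norm hI
    have hn : ‖aC L‖^2 = (L 1)^2 + (L RCLike.I)^2 := by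
      rw [← RCLike.normSq_eq_def', RCLike.normSq_apply]
      simp [aC, RCLike.mul_re, RCLike.mul_im, h1]; ring
    rw [hn, alphaK_one hI]
    have e1 : stdGaussianEntry K (Pi.single true 1) = (Real.sqrt 2)⁻¹ • (RCLike.I : K) := by
      simp [stdGaussianEntry, hI, RCLike.real_smul_eq_coe_mul]; ring
    have e2 : stdGaussianEntry K (Pi.single false 1) = (Real.sqrt 2)⁻¹ • (1 : K) := by
      simp [stdGaussianEntry, hI, RCLike.real_smul_eq_coe_mul]
    rw [e1, e2, map_smul, map_smul]
    simp only [smul_eq_mul, mul_pow, inv_pow, Real.sq_sqrt (show (0:ℝ) ≤ 2 by norm_num)]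
    ring

lemma frobSq_eq_trace {K : Type*} [RCLike K] {m n : Type*} [Fintype m] [Fintype n]
    (A : Matrix m n K) : frobSq A = RCLike.re (Aᴴ * A).trace := by
  simp only [frobSq, Matrix.trace, Matrix.diag, Matrix.mul_apply, Matrix.conjTranspose_apply,
    map_sum, RCLike.star_def, RCLike.conj_mul]
  rw [Finset.sum_comm]
  norm_cast

lemma frobSq_isom {K : Type*} [RCLike K] {m n l : Type*} [Fintype m] [Fintype n] [Fintype l]
    [DecidableEq n]
    (U : Matrix m n K) (hU : Uᴴ * U = 1) (A : Matrix n l K) : frobSq (U * A) = frobSq A := by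
  rw [frobSq_eq_trace, frobSq_eq_trace, Matrix.conjTranspose_mul, Matrix.mul_assoc,
    ← Matrix.mul_assoc Uᴴ, hU, Matrix.one_mul]

abbrev gmat (K : Type*) [RCLike K] [MeasurableSpace K] (m l : Type*) [Fintype m] [Fintype l] :
    Measure (m → l → K) := Measure.pi fun _ : m => Measure.pi fun _ : l => gammaK K

/-- entry functional -/
def sub2 {K : Type*} [RCLike K] {m l : Type*} [Fintype m] [Fintype l] [DecidableEq m]
    [DecidableEq l] (L : (m → l → K) →L[ℝ] ℝ) (i : m) (j : l) : K →L[ℝ] ℝ :=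
  (L.comp (ContinuousLinearMap.single ℝ (fun _ : m => l → K) i)).comp
    (ContinuousLinearMap.single ℝ (fun _ : l => K) j)

lemma charFun_gmat {K : Type*} [RCLike K] [MeasurableSpace K] [BorelSpace K] {m l : Type*}
    [Fintype m] [Fintype l] [DecidableEq m] [DecidableEq l] (L : (m → l → K) →L[ℝ] ℝ) :
    charFunDual (gmat K m l) L = ((Real.exp (-((1 + alphaK K) / 4) *
      frobSq (Matrix.of fun i j => aC (sub2 L i j))) : ℝ) : ℂ) := by
  rw [charFunDual_pi]
  simp only [charFunDual_pi, charFun_gamma, frobSq, Finset.mul_sum, Real.exp_sum, Matrix.of_apply]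
  push_cast
  rfl

lemma gmat_coisom {K : Type*} [RCLike K] [MeasurableSpace K] [BorelSpace K] {m n l : Type*}
    [Fintype m] [Fintype n] [Fintype l] [DecidableEq m] (Q : Matrix m n K) (hQ : Q * Qᴴ = 1) :
    MeasurePreserving (fun (M : n → l → K) (i : m) (j : l) => ∑ k, Q i k * M k j)
      (gmat K n l) (gmat K m l) := by
  classical
  let T : (n → l → K) →L[ℝ] (m → l → K) := LinearMap.toContinuousLinearMap
    { toFun := fun M => (Q * Matrix.of M : Matrix m l K)
      map_add' := by
        intro x y
        exact Matrix.mul_add Q (Matrix.of x) (Matrix.of y)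
      map_smul' := by
        intro c x
        exact Matrix.mul_smul Q c (Matrix.of x) }
  have hT : ∀ M, T M = (Q * Matrix.of M : Matrix m l K) := fun M => rfl
  refine ⟨T.continuous.measurable, ?_⟩
  change Measure.map T _ = _
  apply Measure.ext_of_charFunDual
  ext L
  rw [charFunDual_map, charFun_gmat, charFun_gmat]
  congr 3
  have key : (Matrix.of fun i j => aC (sub2 (L.comp T) i j)) =
      Qᵀ * (Matrix.of fun i j => aC (sub2 L i j)) := by
    ext k j
    have h1 : ∀ z, sub2 (L.comp T) k j z = ∑ i, sub2 L i j (Q i k * z) := by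
      intro z
      simp only [sub2, ContinuousLinearMap.comp_apply, ContinuousLinearMap.single_apply]
      rw [← map_sum]
      congr 1
      rw [hT]
      ext a b
      simp only [Matrix.mul_apply, Matrix.of_apply, Finset.sum_apply]
      rw [Finset.sum_eq_single k, Finset.sum_eq_single a]
      · by_cases hb : b = j
        · subst hb; simp
        · simp [hb]
      · intro c _ hc; simp [Ne.symm hc]
      · simp
      · intro c _ hc; simp [hc]
      · simp
    simp only [Matrix.mul_apply, Matrix.of_apply, Matrix.transpose_apply]
    have h2 : ∀ i, Q i k * aC (sub2 L i j) =
        ((sub2 L i j (Q i k * 1) : ℝ) : K) - RCLike.I * ((sub2 L i j (Q i k * RCLike.I) : ℝ) : K) := by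
      intro i
      let L' : K →L[ℝ] ℝ := (sub2 L i j).comp (ContinuousLinearMap.mul ℝ K (Q i k))
      exact (aC_mul (sub2 L i j) L' (Q i k) (fun z => rfl)).symm
    simp only [h2]
    rw [aC, h1, h1, Finset.sum_sub_distrib, ← Finset.mul_sum]
    push_cast
    rfl
  rw [key, frobSq_isom]
  have : Qᵀᴴ * Qᵀ = (Q * Qᴴ)ᵀ := by
    rw [Matrix.transpose_mul]; rfl
  rw [this, hQ, Matrix.transpose_one]

lemma gvec_coisom {K : Type*} [RCLike K] [MeasurableSpace K] [BorelSpace K] {m n : Type}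
    [Fintype m] [Fintype n] [DecidableEq m] (Q : Matrix m n K) (hQ : Q * Qᴴ = 1) :
    MeasurePreserving (fun v : n → K => Q *ᵥ v)
      (Measure.pi fun _ : n => gammaK K) (Measure.pi fun _ : m => gammaK K) := by
  have key : ∀ (k : Type) [Fintype k], (Measure.pi fun _ : k => gammaK K) =
      (gmat K k Unit).map (fun M i => M i ()) := by
    intro k _
    have h : (Measure.pi fun _ : Unit => gammaK K).map (fun v => v ()) = gammaK K :=
      (measurePreserving_eval (fun _ : Unit => gammaK K) ()).map_eq
    rw [Measure.pi_map_pi (hμ := fun _ => by rw [h]; infer_instance)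
      (fun _ => (measurable_pi_apply ()).aemeasurable), h]
  have hmeas : ∀ (k : Type) [Fintype k], Measurable (fun (M : k → Unit → K) i => M i ()) := by
    intro k _
    exact measurable_pi_lambda _ fun i => (measurable_pi_apply ()).comp (measurable_pi_apply i)
  have hm : Measurable (fun v : n → K => Q *ᵥ v) :=
    (Continuous.matrix_mulVec continuous_const continuous_id).measurable
  refine ⟨hm, ?_⟩
  rw [key n, key m, Measure.map_map hm (hmeas n), ← (gmat_coisom (l := Unit) Q hQ).map_eq,
    Measure.map_map (hmeas m) (gmat_coisom (l := Unit) Q hQ).measurable]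
  rfl

lemma gaussianReal_laplace (t : ℝ) (ht : 0 ≤ t) :
    ∫ x, Real.exp (-t * x ^ 2) ∂(gaussianReal 0 1) = (1 + 2 * t) ^ (-(1 / 2) : ℝ) := by
  rw [integral_gaussianReal_eq_integral_smul (by norm_num)]
  have h : ∀ x : ℝ, gaussianPDFReal 0 1 x • Real.exp (-t * x ^ 2) =
      (√(2 * Real.pi))⁻¹ * Real.exp (-(t + 1 / 2) * x ^ 2) := by
    intro x
    rw [gaussianPDFReal_def]
    simp only [NNReal.coe_one, mul_one, sub_zero, smul_eq_mul]
    rw [mul_assoc, ← Real.exp_add]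
    congr 2; ring
  simp only [h]
  rw [integral_const_mul, integral_gaussian, ← Real.sqrt_inv, ← Real.sqrt_mul (by positivity),
    Real.sqrt_eq_rpow, Real.rpow_neg (by positivity), ← Real.inv_rpow (by positivity)]
  congr 1
  have := Real.pi_pos
  field_simp
  ring

lemma gamma_laplace (K : Type*) [RCLike K] [MeasurableSpace K] [BorelSpace K] (t : ℝ) (ht : 0 ≤ t) :
    ∫ z, Real.exp (-t * ‖z‖ ^ 2) ∂(gammaK K) =
      (1 + (1 + alphaK K) * t) ^ (-(1 / (1 + alphaK K)) : ℝ) := by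
  unfold gammaK
  have hc : Continuous fun z : K => Real.exp (-t * ‖z‖ ^ 2) := by fun_prop
  rw [integral_map (measurable_entry K).aemeasurable hc.aestronglyMeasurable]
  by_cases hI : (RCLike.I : K) = 0
  · rw [alphaK_zero hI]
    have h : ∀ v : Bool → ℝ, Real.exp (-t * ‖stdGaussianEntry K v‖ ^ 2) =
        (fun x : ℝ => Real.exp (-t * x ^ 2)) (v false) := by
      intro v; simp [stdGaussianEntry, hI]
    simp only [h]
    rw [integral_comp_eval (μ := fun _ : Bool => gaussianReal 0 1)
      (f := fun x : ℝ => Real.exp (-t * x ^ 2)) (by fun_prop), gaussianReal_laplace t ht]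
    norm_num
  · rw [alphaK_one hI]
    have h1 := I_ne_norm hI
    have h : ∀ v : Bool → ℝ, Real.exp (-t * ‖stdGaussianEntry K v‖ ^ 2) =
        ∏ b, Real.exp (-(t / 2) * (v b) ^ 2) := by
      intro v
      have : ‖stdGaussianEntry K v‖ ^ 2 = ((v false) ^ 2 + (v true) ^ 2) / 2 := by
        simp only [stdGaussianEntry, hI, if_false, norm_div, div_pow]
        rw [RCLike.norm_ofReal, sq_abs, Real.sq_sqrt (by norm_num), ← RCLike.normSq_eq_def',
          RCLike.normSq_apply]
        simp [RCLike.mul_re, RCLike.mul_im, h1]; ring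
      rw [this, Fintype.univ_bool, Finset.prod_pair (by decide), ← Real.exp_add]
      congr 1; ring
    simp only [h]
    rw [integral_fintype_prod_eq_pow (fun x : ℝ => Real.exp (-(t / 2) * x ^ 2)),
      gaussianReal_laplace _ (by positivity), Fintype.card_bool, ← Real.rpow_mul_natCast (by positivity)]
    norm_num
    congr 2; ring

lemma lint_sq_gaussianReal : ∫⁻ x, ENNReal.ofReal (x ^ 2) ∂(gaussianReal 0 1) = 1 := by
  have hsqI : Integrable (fun x : ℝ => x ^ 2) (gaussianReal 0 1) :=
    (memLp_id_gaussianReal (μ := 0) (v := 1) 2).integrable_sq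
  rw [← ofReal_integral_eq_lintegral_ofReal hsqI (ae_of_all _ fun x => sq_nonneg x)]
  have := variance_fun_id_gaussianReal (μ := 0) (v := 1)
  rw [variance_of_integral_eq_zero (by fun_prop) integral_id_gaussianReal] at this
  rw [this]; simp

lemma gamma_second (K : Type*) [RCLike K] [MeasurableSpace K] [BorelSpace K] :
    ∫⁻ z, ENNReal.ofReal (‖z‖ ^ 2) ∂(gammaK K) = 1 := by
  unfold gammaK
  rw [lintegral_map (by fun_prop) (measurable_entry K)]
  have he : ∀ b : Bool, ∫⁻ v : Bool → ℝ, ENNReal.ofReal ((v b) ^ 2)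
      ∂(Measure.pi fun _ : Bool => gaussianReal 0 1) = 1 := by
    intro b
    rw [← lint_sq_gaussianReal]
    exact (measurePreserving_eval (fun _ : Bool => gaussianReal 0 1) b).lintegral_comp
      (f := fun x : ℝ => ENNReal.ofReal (x ^ 2)) (by fun_prop)
  by_cases hI : (RCLike.I : K) = 0
  · rw [← he false]
    congr 1; ext v
    simp [stdGaussianEntry, hI]
  · have h1 := I_ne_norm hI
    have h : ∀ v : Bool → ℝ, ENNReal.ofReal (‖stdGaussianEntry K v‖ ^ 2) =
        ENNReal.ofReal (1 / 2) * (ENNReal.ofReal ((v false) ^ 2) + ENNReal.ofReal ((v true) ^ 2)) := by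
      intro v
      have : ‖stdGaussianEntry K v‖ ^ 2 = (1 / 2) * ((v false) ^ 2 + (v true) ^ 2) := by
        simp only [stdGaussianEntry, hI, if_false, norm_div, div_pow]
        rw [RCLike.norm_ofReal, sq_abs, Real.sq_sqrt (by norm_num), ← RCLike.normSq_eq_def',
          RCLike.normSq_apply]
        simp [RCLike.mul_re, RCLike.mul_im, h1]; ring
      rw [this, ENNReal.ofReal_mul (by norm_num), ENNReal.ofReal_add (sq_nonneg _) (sq_nonneg _)]
    simp only [h]
    rw [lintegral_const_mul _ (by fun_prop), lintegral_add_left (by fun_prop), he, he]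
    rw [← ENNReal.ofReal_one, ← ENNReal.ofReal_add (by norm_num) (by norm_num),
      ← ENNReal.ofReal_mul (by norm_num)]
    norm_num

lemma inv_eq_lint (x : ℝ) (hx : 0 ≤ x) :
    (ENNReal.ofReal x)⁻¹ = ∫⁻ t in Set.Ioi (0:ℝ), ENNReal.ofReal (Real.exp (-t * x)) := by
  rcases hx.eq_or_lt with rfl | hx
  · simp
  · have hi : IntegrableOn (fun t : ℝ => Real.exp (-t * x)) (Set.Ioi 0) := by
      have := integrableOn_exp_mul_Ioi (a := -x) (by linarith) 0
      refine this.congr_fun (fun t _ => ?_) measurableSet_Ioi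
      dsimp; congr 1; ring
    rw [← ofReal_integral_eq_lintegral_ofReal hi (ae_of_all _ fun t => (Real.exp_pos _).le),
      ← ENNReal.ofReal_inv_of_pos hx]
    congr 1
    have := integral_exp_mul_Ioi (a := -x) (by linarith) 0
    simp only [mul_zero, Real.exp_zero] at this
    rw [show (fun t : ℝ => Real.exp (-t * x)) = fun t => Real.exp (-x * t) by
      ext t; congr 1; ring, this]
    field_simp

lemma int_pow (a s : ℝ) (ha : 0 < a) (hs : 1 < s) :
    ∫⁻ t in Set.Ioi (0:ℝ), ENNReal.ofReal ((1 + a * t) ^ (-s)) = ENNReal.ofReal (1 / (a * (s - 1))) := by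
  have hderiv : ∀ t ∈ Set.Ici (0:ℝ), HasDerivAt (fun t : ℝ => -(1 / (a * (s - 1))) * (1 + a * t) ^ (1 - s))
      ((1 + a * t) ^ (-s)) t := by
    intro t ht
    have ht : 0 ≤ t := ht
    have hp : 0 < 1 + a * t := by positivity
    have h1 : HasDerivAt (fun t : ℝ => 1 + a * t) a t := by
      simpa using ((hasDerivAt_id t).const_mul a).const_add 1
    have h2 := (h1.rpow_const (p := 1 - s) (Or.inl hp.ne')).const_mul (-(1 / (a * (s - 1))))
    refine h2.congr_deriv ?_
    have : s - 1 ≠ 0 := by linarith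
    rw [show 1 - s - 1 = -s by ring]
    field_simp
    ring
  have hlim : Tendsto (fun t : ℝ => -(1 / (a * (s - 1))) * (1 + a * t) ^ (1 - s)) atTop (𝓝 0) := by
    have h1 : Tendsto (fun t : ℝ => 1 + a * t) atTop atTop :=
      tendsto_atTop_add_const_left _ _ (tendsto_id.const_mul_atTop ha)
    have h2 := (tendsto_rpow_neg_atTop (show 0 < s - 1 by linarith)).comp h1
    have h3 := h2.const_mul (-(1 / (a * (s - 1))))
    rw [mul_zero] at h3
    refine h3.congr fun t => ?_
    simp
  have hpos : ∀ t ∈ Set.Ioi (0:ℝ), 0 ≤ (1 + a * t) ^ (-s) := by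
    intro t ht
    have ht : 0 < t := ht
    positivity
  have hi : IntegrableOn (fun t : ℝ => (1 + a * t) ^ (-s)) (Set.Ioi 0) :=
    integrableOn_Ioi_deriv_of_nonneg' hderiv hpos hlim
  rw [← ofReal_integral_eq_lintegral_ofReal hi
    ((ae_restrict_iff' measurableSet_Ioi).2 (ae_of_all _ hpos)),
    integral_Ioi_of_hasDerivAt_of_nonneg' hderiv hpos hlim]
  simp

lemma inv_moment (K : Type*) [RCLike K] [MeasurableSpace K] [BorelSpace K] (m : ℕ)
    (hm : 1 + alphaK K < m) :
    ∫⁻ z : Fin m → K, (ENNReal.ofReal (∑ i, ‖z i‖ ^ 2))⁻¹ ∂(Measure.pi fun _ => gammaK K) =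
      ENNReal.ofReal (1 / (m - 1 - alphaK K)) := by
  have ha : 0 < 1 + alphaK K := by
    unfold alphaK; split_ifs <;> norm_num
  have h1 : ∀ z : Fin m → K, (ENNReal.ofReal (∑ i, ‖z i‖ ^ 2))⁻¹ =
      ∫⁻ t in Set.Ioi (0:ℝ), ENNReal.ofReal (Real.exp (-t * ∑ i, ‖z i‖ ^ 2)) := fun z =>
    inv_eq_lint _ (Finset.sum_nonneg fun i _ => sq_nonneg _)
  simp only [h1]
  rw [lintegral_lintegral_swap (by fun_prop)]
  have h2 : ∀ t ∈ Set.Ioi (0:ℝ), ∫⁻ z : Fin m → K, ENNReal.ofReal (Real.exp (-t * ∑ i, ‖z i‖ ^ 2))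
      ∂(Measure.pi fun _ => gammaK K) =
      ENNReal.ofReal ((1 + (1 + alphaK K) * t) ^ (-(m / (1 + alphaK K)))) := by
    intro t ht
    have ht : 0 < t := ht
    have hi : Integrable (fun z : Fin m → K => Real.exp (-t * ∑ i, ‖z i‖ ^ 2))
        (Measure.pi fun _ => gammaK K) := by
      have hmeas : Measurable (fun z : Fin m → K => Real.exp (-t * ∑ i, ‖z i‖ ^ 2)) := by fun_prop
      refine Integrable.of_bound (C := 1) hmeas.aestronglyMeasurable (ae_of_all _ fun z => ?_)
      rw [Real.norm_eq_abs, abs_of_pos (Real.exp_pos _)]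
      apply Real.exp_le_one_iff.2
      have : 0 ≤ ∑ i, ‖z i‖ ^ 2 := Finset.sum_nonneg fun i _ => sq_nonneg _
      nlinarith
    rw [← ofReal_integral_eq_lintegral_ofReal hi (ae_of_all _ fun t => (Real.exp_pos _).le)]
    congr 1
    simp only [Finset.mul_sum, Real.exp_sum]
    rw [integral_fintype_prod_eq_pow (fun z : K => Real.exp (-t * ‖z‖ ^ 2)),
      gamma_laplace K t ht.le, Fintype.card_fin, ← Real.rpow_mul_natCast (by positivity)]
    congr 1; ring
  rw [setLIntegral_congr_fun measurableSet_Ioi h2, int_pow _ _ ha (by rw [lt_div_iff₀ ha]; linarith)]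
  congr 2
  field_simp
  ring

lemma exists_onb {K : Type*} [RCLike K] {n r : ℕ} (V : Submodule K (EuclideanSpace K (Fin n)))
    (hr : Module.finrank K V = r) :
    ∃ Q : Matrix (Fin n) (Fin r) K, Qᴴ * Q = 1 ∧
      ∀ y : Fin n → K, WithLp.toLp 2 (Q *ᵥ (Qᴴ *ᵥ y)) = V.starProjection (WithLp.toLp 2 y) := by
  subst hr
  let b := stdOrthonormalBasis K V
  refine ⟨Matrix.of fun i k => (b k : EuclideanSpace K (Fin n)) i, ?_, ?_⟩
  · ext k l
    have h := orthonormal_iff_ite.1 b.orthonormal k l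
    rw [Submodule.coe_inner, EuclideanSpace.inner_eq_star_dotProduct] at h
    rw [Matrix.one_apply, ← h, Matrix.mul_apply, dotProduct]
    refine Finset.sum_congr rfl fun i _ => ?_
    simp [mul_comm]
  · intro y
    rw [b.starProjection_eq_sum_rankOne]
    ext i
    simp only [Matrix.mulVec, dotProduct, _root_.sum_apply, InnerProductSpace.rankOne_apply]
    simp only [WithLp.ofLp_sum, Finset.sum_apply, WithLp.ofLp_smul, Pi.smul_apply, smul_eq_mul]
    refine Finset.sum_congr rfl fun k _ => ?_
    rw [EuclideanSpace.inner_eq_star_dotProduct, mul_comm, dotProduct]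
    congr 1
    refine Finset.sum_congr rfl fun i _ => ?_
    simp [mul_comm]

lemma exists_colbasis {K : Type*} [RCLike K] {n d : ℕ} (A : Matrix (Fin n) (Fin d) K) :
    ∃ Q : Matrix (Fin n) (Fin A.rank) K, Qᴴ * Q = 1 ∧ Q * (Qᴴ * A) = A ∧
      ∃ S : Matrix (Fin d) (Fin A.rank) K, Q = A * S := by
  let e := (WithLp.linearEquiv 2 K (Fin n → K)).symm
  let V : Submodule K (EuclideanSpace K (Fin n)) := (LinearMap.range A.mulVecLin).map e.toLinearMap
  have hV : Module.finrank K V = A.rank := by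
    rw [Matrix.rank]
    exact LinearEquiv.finrank_map_eq e _
  obtain ⟨Q, h1, h2⟩ := exists_onb V hV
  have hfix : ∀ x : Fin d → K, Q *ᵥ (Qᴴ *ᵥ (A *ᵥ x)) = A *ᵥ x := by
    intro x
    have hm : WithLp.toLp 2 (A *ᵥ x) ∈ V := ⟨A *ᵥ x, ⟨x, rfl⟩, rfl⟩
    have := h2 (A *ᵥ x)
    rw [Submodule.starProjection_eq_self_iff.2 hm] at this
    exact WithLp.toLp_injective 2 this
  have hcol : ∀ k : Fin A.rank, ∃ s : Fin d → K, A *ᵥ s = Q *ᵥ (Pi.single k 1) := by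
    intro k
    have h3 := h2 (Q *ᵥ (Pi.single k 1))
    rw [Matrix.mulVec_mulVec (M := Qᴴ), h1, Matrix.one_mulVec] at h3
    have hm : WithLp.toLp 2 (Q *ᵥ (Pi.single k 1)) ∈ V := by
      rw [h3]; exact Submodule.starProjection_apply_mem _ _
    obtain ⟨_, ⟨s, rfl⟩, hs⟩ := hm
    exact ⟨s, WithLp.toLp_injective 2 hs⟩
  choose s hs using hcol
  refine ⟨Q, h1, ?_, Matrix.of fun i k => s k i, ?_⟩
  · apply Matrix.toLin'.injective
    ext x i
    have := congrFun (hfix (Pi.single x 1)) i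
    simpa [Matrix.mulVec_mulVec] using this
  · ext i k
    have := congrFun (hs k) i
    rw [Matrix.mulVec_single_one] at this
    rw [Matrix.mul_apply]
    simpa [Matrix.mulVec, dotProduct] using this.symm

lemma exists_complement {K : Type*} [RCLike K] {r l : ℕ} (Y : Fin r → Fin l → K)
    (hY : LinearIndependent K Y) :
    ∃ T : Matrix (Fin (l - r)) (Fin l) K, T * Tᴴ = 1 ∧ (∀ k, T *ᵥ Y k = 0) ∧
      ∀ y : Fin l → K, ∃ c : Fin r → K, y - Tᴴ *ᵥ (T *ᵥ y) = ∑ k, c k • Y k := by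
  let e := (WithLp.linearEquiv 2 K (Fin l → K)).symm
  let Y2 : Fin r → EuclideanSpace K (Fin l) := fun k => e (Y k)
  have hY2 : LinearIndependent K Y2 := hY.map' e.toLinearMap e.ker
  let V : Submodule K (EuclideanSpace K (Fin l)) := Submodule.span K (Set.range Y2)
  have hV : Module.finrank K Vᗮ = l - r := by
    have h1 := Submodule.finrank_add_finrank_orthogonal V
    rw [finrank_span_eq_card hY2, finrank_euclideanSpace, Fintype.card_fin, Fintype.card_fin] at h1
    omega
  obtain ⟨Q, h1, h2⟩ := exists_onb Vᗮ hV
  refine ⟨Qᴴ, by simpa using h1, ?_, ?_⟩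
  · intro k
    have h3 := h2 (Y k)
    have hm : WithLp.toLp 2 (Y k) ∈ Vᗮᗮ :=
      Submodule.le_orthogonal_orthogonal V (Submodule.subset_span ⟨k, rfl⟩)
    rw [(Submodule.starProjection_apply_eq_zero_iff _).2 hm] at h3
    have h4 : Q *ᵥ (Qᴴ *ᵥ Y k) = 0 := WithLp.toLp_injective 2 h3
    have h5 := congrArg (fun v => Qᴴ *ᵥ v) h4
    simpa [Matrix.mulVec_mulVec, ← Matrix.mul_assoc, h1] using h5
  · intro y
    have hm : WithLp.toLp 2 y - Vᗮ.starProjection (WithLp.toLp 2 y) ∈ V := by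
      have := Submodule.sub_starProjection_mem_orthogonal (K := Vᗮ) (WithLp.toLp 2 y)
      rwa [Submodule.orthogonal_orthogonal] at this
    rw [← h2] at hm
    obtain ⟨c, hc⟩ := (Submodule.mem_span_range_iff_exists_fun K).1 hm
    refine ⟨c, ?_⟩
    rw [Matrix.conjTranspose_conjTranspose]
    apply WithLp.toLp_injective 2
    rw [WithLp.toLp_sub, ← hc]
    exact (map_sum e _ _).trans (by simp [Y2]) |>.symm

lemma linInd_iff_rank {K : Type*} [RCLike K] {r l : ℕ} (Y : Matrix (Fin r) (Fin l) K) :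
    LinearIndependent K Y.row ↔ Y.rank = r := by
  rw [linearIndependent_iff_card_eq_finrank_span, Matrix.rank_eq_finrank_span_row, Fintype.card_fin,
    eq_comm]
  rfl

lemma linInd_iff_det {K : Type*} [RCLike K] {r l : ℕ} (Y : Matrix (Fin r) (Fin l) K) :
    LinearIndependent K Y.row ↔ (Y * Yᴴ).det ≠ 0 := by
  rw [← isUnit_iff_ne_zero, ← Matrix.isUnit_iff_isUnit_det, ← Matrix.linearIndependent_rows_iff_isUnit,
    linInd_iff_rank, linInd_iff_rank, Matrix.rank_self_mul_conjTranspose]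

/-- pseudo-inverse rows -/
def Wm {K : Type*} [RCLike K] {r l : ℕ} (Y : Matrix (Fin r) (Fin l) K) : Matrix (Fin r) (Fin l) K :=
  (Y * Yᴴ)⁻¹ * Y

lemma sum_norm_sq_cast {K : Type*} [RCLike K] {l : ℕ} (w : Fin l → K) :
    star w ⬝ᵥ w = ((∑ i, ‖w i‖ ^ 2 : ℝ) : K) := by
  simp only [dotProduct, Pi.star_apply, RCLike.star_def, RCLike.conj_mul]
  push_cast; rfl

lemma Wm_formula {K : Type*} [RCLike K] {r l m : ℕ} (Y' : Fin r → Fin l → K)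
    (hY : LinearIndependent K Y') (T : Matrix (Fin m) (Fin l) K)
    (hT : ∀ k, T *ᵥ Y' k = 0)
    (hTc : ∀ y : Fin l → K, ∃ c : Fin r → K, y - Tᴴ *ᵥ (T *ᵥ y) = ∑ k, c k • Y' k)
    (j : Fin (r + 1)) (y : Fin l → K) (hy : T *ᵥ y ≠ 0) :
    LinearIndependent K (j.insertNth (α := fun _ => Fin l → K) y Y') ∧
      ∑ i, ‖Wm (Matrix.of (j.insertNth (α := fun _ => Fin l → K) y Y')) j i‖ ^ 2 =
        (∑ k, ‖(T *ᵥ y) k‖ ^ 2)⁻¹ := by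
  set Y : Fin (r + 1) → Fin l → K := j.insertNth (α := fun _ => Fin l → K) y Y' with hYdef
  set s : ℝ := ∑ k, ‖(T *ᵥ y) k‖ ^ 2 with hs
  have hs0 : s ≠ 0 := by
    intro h0
    apply hy
    ext k
    have := (Finset.sum_eq_zero_iff_of_nonneg (fun k _ => sq_nonneg ‖(T *ᵥ y) k‖)).1 h0 k
      (Finset.mem_univ k)
    simpa using this
  have hsK : (s : K) ≠ 0 := by exact_mod_cast hs0
  let w : Fin l → K := (s : K)⁻¹ • (Tᴴ *ᵥ (T *ᵥ y))
  have hdot : ∀ v, star w ⬝ᵥ v = (s : K)⁻¹ * (star (T *ᵥ y) ⬝ᵥ (T *ᵥ v)) := by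
    intro v
    simp only [w, star_smul, smul_dotProduct, smul_eq_mul]
    rw [Matrix.star_mulVec (M := Tᴴ), Matrix.conjTranspose_conjTranspose, ← Matrix.dotProduct_mulVec]
    simp
  have hd1 : ∀ k, star w ⬝ᵥ Y' k = 0 := by intro k; rw [hdot, hT]; simp
  have hd2 : star w ⬝ᵥ y = 1 := by
    rw [hdot, sum_norm_sq_cast, ← hs, inv_mul_cancel₀ hsK]
  have hYj : Y j = y := by simp [hYdef]
  have hYk : ∀ k, Y (j.succAbove k) = Y' k := by intro k; simp [hYdef]
  have hd : ∀ i, star w ⬝ᵥ Y i = (Pi.single j 1 : Fin (r + 1) → K) i := by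
    intro i
    rcases Fin.eq_self_or_eq_succAbove j i with rfl | ⟨k, rfl⟩
    · rw [hYj, hd2]; simp
    · rw [hYk, hd1]; simp [Fin.succAbove_ne]
  have hLI : LinearIndependent K Y := by
    rw [Fintype.linearIndependent_iff]
    intro g hg
    have hgj : g j = 0 := by
      have := congrArg (fun v => star w ⬝ᵥ v) hg
      simp only [dotProduct_sum, dotProduct_smul, hd, dotProduct_zero] at this
      simpa [Pi.single_apply] using this
    have hg2 : ∑ k, g (j.succAbove k) • Y' k = 0 := by
      rw [Fin.sum_univ_succAbove _ j, hgj, zero_smul, zero_add] at hg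
      simpa only [hYk] using hg
    have hg3 := Fintype.linearIndependent_iff.1 hY _ hg2
    intro i
    rcases Fin.eq_self_or_eq_succAbove j i with rfl | ⟨k, rfl⟩
    · exact hgj
    · exact hg3 k
  refine ⟨hLI, ?_⟩
  obtain ⟨c, hc⟩ := hTc y
  let a : Fin (r + 1) → K := j.insertNth (α := fun _ => K) (s : K)⁻¹ (fun k => -((s : K)⁻¹ * c k))
  have hw : w = a ᵥ* Matrix.of Y := by
    rw [Matrix.vecMul_eq_sum, Fin.sum_univ_succAbove _ j]
    have hrow : ∀ i, (Matrix.of Y) i = Y i := fun i => rfl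
    simp only [a, Fin.insertNth_apply_same, Fin.insertNth_apply_succAbove, hrow, hYj, hYk, neg_smul,
      mul_smul, Finset.sum_neg_distrib, ← Finset.smul_sum]
    rw [← hc, ← smul_neg, ← smul_add]
    show (s : K)⁻¹ • (Tᴴ *ᵥ (T *ᵥ y)) = _
    congr 1
    abel
  have hYw : Matrix.of Y *ᵥ star w = Pi.single j 1 := by
    ext i
    rw [← hd i, dotProduct_comm]; rfl
  have hwY : w ᵥ* (Matrix.of Y)ᴴ = Pi.single j 1 := by
    have := congrArg star hYw
    rw [Matrix.star_mulVec, star_star] at this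
    rw [this]
    ext i
    by_cases h : i = j
    · subst h; simp
    · simp [h]
  have hdet : IsUnit (Matrix.of Y * (Matrix.of Y)ᴴ).det :=
    isUnit_iff_ne_zero.2 ((linInd_iff_det (Matrix.of Y)).1 hLI)
  have ha : a = Pi.single j 1 ᵥ* (Matrix.of Y * (Matrix.of Y)ᴴ)⁻¹ := by
    rw [← hwY, hw, Matrix.vecMul_vecMul, Matrix.vecMul_vecMul, ← Matrix.mul_assoc,
      Matrix.mul_nonsing_inv _ hdet,
      Matrix.vecMul_one]
  have hrow : ∀ i, Wm (Matrix.of Y) j i = w i := by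
    intro i
    rw [hw, ha, Matrix.vecMul_vecMul, Matrix.single_one_vecMul]
    rfl
  simp only [hrow]
  have h1 := sum_norm_sq_cast w
  have h2 : star w ⬝ᵥ w = (s : K)⁻¹ := by
    calc star w ⬝ᵥ w = w ⬝ᵥ star w := dotProduct_comm _ _
      _ = (a ᵥ* Matrix.of Y) ⬝ᵥ star w := by rw [← hw]
      _ = a ⬝ᵥ (Matrix.of Y *ᵥ star w) := (Matrix.dotProduct_mulVec _ _ _).symm
      _ = (s : K)⁻¹ := by rw [hYw]; simp [a]
  rw [h2] at h1
  have h3 : ((s⁻¹ : ℝ) : K) = ((∑ i, ‖w i‖ ^ 2 : ℝ) : K) := by rw [← h1]; push_cast; rfl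
  exact (RCLike.ofReal_injective h3).symm

lemma mp_insert {X : Type*} [MeasurableSpace X] (μ : Measure X) [IsProbabilityMeasure μ] (r : ℕ)
    (j : Fin (r + 1)) :
    MeasurePreserving (fun p : (Fin r → X) × X => j.insertNth (α := fun _ => X) p.2 p.1)
      ((Measure.pi fun _ => μ).prod μ) (Measure.pi fun _ => μ) := by
  have h1 := (measurePreserving_piFinSuccAbove (fun _ : Fin (r + 1) => μ) j).symm
  have h2 : MeasurePreserving (Prod.swap : (Fin r → X) × X → _) ((Measure.pi fun _ => μ).prod μ)
      (μ.prod (Measure.pi fun _ => μ)) := Measure.measurePreserving_swap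
  exact h1.comp h2

lemma measurable_det {K : Type*} [RCLike K] [MeasurableSpace K] [BorelSpace K] {r l : ℕ} :
    Measurable fun Y : Fin r → Fin l → K => (Matrix.of Y * (Matrix.of Y)ᴴ).det := by
  have : Continuous fun Y : Fin r → Fin l → K => (Matrix.of Y * (Matrix.of Y)ᴴ).det := by
    have h : Continuous fun Y : Fin r → Fin l → K => Matrix.of Y := continuous_id
    exact (h.matrix_mul h.matrix_conjTranspose).matrix_det
  exact this.measurable

lemma measurableSet_LI {K : Type*} [RCLike K] [MeasurableSpace K] [BorelSpace K] {r l : ℕ} :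
    MeasurableSet {Y : Fin r → Fin l → K | LinearIndependent K Y} := by
  have : {Y : Fin r → Fin l → K | LinearIndependent K Y} =
      (fun Y : Fin r → Fin l → K => (Matrix.of Y * (Matrix.of Y)ᴴ).det) ⁻¹' {0}ᶜ := by
    ext Y
    exact linInd_iff_det (Matrix.of Y)
  rw [this]
  exact measurable_det (measurableSet_singleton 0).compl

lemma measurable_Wm {K : Type*} [RCLike K] [MeasurableSpace K] [BorelSpace K] {r l : ℕ}
    (j : Fin r) (i : Fin l) :
    Measurable fun Y : Fin r → Fin l → K => Wm (Matrix.of Y) j i := by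
  have h : Continuous fun Y : Fin r → Fin l → K => Matrix.of Y := continuous_id
  have h2 : Continuous fun Y : Fin r → Fin l → K =>
      ((Matrix.of Y * (Matrix.of Y)ᴴ).adjugate * Matrix.of Y) j i :=
    ((h.matrix_mul h.matrix_conjTranspose).matrix_adjugate.matrix_mul h).matrix_elem j i
  have : (fun Y : Fin r → Fin l → K => Wm (Matrix.of Y) j i) = fun Y =>
      ((Matrix.of Y * (Matrix.of Y)ᴴ).det)⁻¹ *
        ((Matrix.of Y * (Matrix.of Y)ᴴ).adjugate * Matrix.of Y) j i := by
    ext Y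
    rw [Wm, Matrix.inv_def, Ring.inverse_eq_inv', Matrix.smul_mul]
    rfl
  rw [this]
  exact measurable_det.inv.mul h2.measurable

lemma inner_int {K : Type*} [RCLike K] [MeasurableSpace K] [BorelSpace K] {r l : ℕ}
    (hr : ((r + 1 : ℕ) : ℝ) < l - alphaK K) (T : Matrix (Fin (l - r)) (Fin l) K) (hT : T * Tᴴ = 1) :
    ∫⁻ y, (ENNReal.ofReal (∑ k, ‖(T *ᵥ y) k‖ ^ 2))⁻¹ ∂(Measure.pi fun _ : Fin l => gammaK K) =
      ENNReal.ofReal (1 / (l - (r + 1 : ℕ) - alphaK K)) := by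
  have ha : 0 ≤ alphaK K := by
    unfold alphaK; split_ifs <;> norm_num
  have hrl : r ≤ l := by
    have : ((r + 1 : ℕ) : ℝ) < l := by linarith
    have : r + 1 < l := by exact_mod_cast this
    omega
  have h := (gvec_coisom T hT).lintegral_comp
    (f := fun z : Fin (l - r) → K => (ENNReal.ofReal (∑ k, ‖z k‖ ^ 2))⁻¹) (by fun_prop)
  rw [h, inv_moment]
  · push_cast [Nat.cast_sub hrl]
    congr 2; ring
  · push_cast [Nat.cast_sub hrl] at hr ⊢
    linarith

lemma inner_ae {K : Type*} [RCLike K] [MeasurableSpace K] [BorelSpace K] {r l : ℕ}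
    (hr : ((r + 1 : ℕ) : ℝ) < l - alphaK K) (T : Matrix (Fin (l - r)) (Fin l) K) (hT : T * Tᴴ = 1) :
    ∀ᵐ y ∂(Measure.pi fun _ : Fin l => gammaK K), T *ᵥ y ≠ 0 := by
  have h := inner_int hr T hT
  have hm : Measurable fun y : Fin l → K => (ENNReal.ofReal (∑ k, ‖(T *ᵥ y) k‖ ^ 2))⁻¹ := by
    have h2 := (gvec_coisom T hT).measurable
    fun_prop
  have := ae_lt_top hm (by rw [h]; exact ENNReal.ofReal_ne_top)
  filter_upwards [this] with y hy h0
  simp [h0] at hy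

lemma ae_LI (K : Type*) [RCLike K] [MeasurableSpace K] [BorelSpace K] (l : ℕ) : ∀ (r : ℕ)
    (_ : (r : ℝ) < l - alphaK K), ∀ᵐ Y ∂(gmat K (Fin r) (Fin l)), LinearIndependent K Y := by
  intro r
  induction r with
  | zero => intro _; exact ae_of_all _ fun Y => linearIndependent_empty_type
  | succ r ih =>
    intro hr
    have ih := ih (by push_cast at hr; linarith)
    have mp := mp_insert (Measure.pi fun _ : Fin l => gammaK K) r 0
    rw [gmat, ← mp.map_eq, ae_map_iff mp.measurable.aemeasurable measurableSet_LI]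
    refine (Measure.ae_prod_mem_iff_ae_ae_mem (mp.measurable measurableSet_LI)).2 ?_
    filter_upwards [ih] with Y' hY'
    obtain ⟨T, h1, h2, h3⟩ := exists_complement Y' hY'
    filter_upwards [inner_ae hr T h1] with y hy
    exact (Wm_formula Y' hY' T h2 h3 0 y hy).1

lemma Wm_int {K : Type*} [RCLike K] [MeasurableSpace K] [BorelSpace K] {r l : ℕ}
    (hr : (r : ℝ) < l - alphaK K) (j : Fin r) :
    ∫⁻ Y, ENNReal.ofReal (∑ i, ‖Wm (Matrix.of Y) j i‖ ^ 2) ∂(gmat K (Fin r) (Fin l)) =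
      ENNReal.ofReal (1 / (l - r - alphaK K)) := by
  obtain _ | r := r
  · exact j.elim0
  have hm : Measurable fun Y : Fin (r + 1) → Fin l → K =>
      ENNReal.ofReal (∑ i, ‖Wm (Matrix.of Y) j i‖ ^ 2) := by
    have := fun i => measurable_Wm (K := K) (l := l) j i
    fun_prop
  have mp := mp_insert (Measure.pi fun _ : Fin l => gammaK K) r j
  rw [gmat, ← mp.lintegral_comp hm]
  refine (lintegral_prod _ (hm.comp mp.measurable).aemeasurable).trans ?_
  have hc : ∀ᵐ Y' ∂(gmat K (Fin r) (Fin l)),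
      ∫⁻ y, ENNReal.ofReal (∑ i, ‖Wm (Matrix.of (j.insertNth (α := fun _ => Fin l → K) y Y')) j i‖ ^ 2)
        ∂(Measure.pi fun _ : Fin l => gammaK K) =
      ENNReal.ofReal (1 / (l - (r + 1 : ℕ) - alphaK K)) := by
    filter_upwards [ae_LI K l r (by push_cast at hr; linarith)] with Y' hY'
    obtain ⟨T, h1, h2, h3⟩ := exists_complement Y' hY'
    rw [← inner_int hr T h1]
    apply lintegral_congr_ae
    filter_upwards [inner_ae hr T h1] with y hy
    rw [(Wm_formula Y' hY' T h2 h3 j y hy).2, ENNReal.ofReal_inv_of_pos]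
    refine lt_of_le_of_ne (Finset.sum_nonneg fun k _ => sq_nonneg _) fun h0 => hy ?_
    ext k
    have := (Finset.sum_eq_zero_iff_of_nonneg (fun k _ => sq_nonneg ‖(T *ᵥ y) k‖)).1 h0.symm k
      (Finset.mem_univ k)
    simpa using this
  refine (lintegral_congr_ae hc).trans ?_
  simp

lemma lin_second {K : Type*} [RCLike K] [MeasurableSpace K] [BorelSpace K] {l : ℕ} (w : Fin l → K) :
    ∫⁻ h, ENNReal.ofReal (‖∑ i, star (w i) * h i‖ ^ 2) ∂(Measure.pi fun _ : Fin l => gammaK K) =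
      ENNReal.ofReal (∑ i, ‖w i‖ ^ 2) := by
  set s : ℝ := ∑ i, ‖w i‖ ^ 2 with hs
  have hs0 : 0 ≤ s := Finset.sum_nonneg fun k _ => sq_nonneg _
  rcases hs0.eq_or_lt with h0 | h0
  · have hw : ∀ i, w i = 0 := by
      intro i
      have := (Finset.sum_eq_zero_iff_of_nonneg (fun k _ => sq_nonneg ‖w k‖)).1 h0.symm i
        (Finset.mem_univ i)
      simpa using this
    simp [hw, ← h0]
  · let Q : Matrix (Fin 1) (Fin l) K := Matrix.of fun _ i => ((√s)⁻¹ : ℝ) * star (w i)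
    have hQ : Q * Qᴴ = 1 := by
      ext a b
      have hab : a = b := Subsingleton.elim _ _
      subst hab
      rw [Matrix.mul_apply, Matrix.one_apply_eq]
      have : ∀ i, Q a i * Qᴴ i a = (s : K)⁻¹ * (star (w i) * w i) := by
        intro i
        have : (((√s)⁻¹ : ℝ) : K) * (((√s)⁻¹ : ℝ) : K) = (s : K)⁻¹ := by
          rw [← RCLike.ofReal_mul, ← mul_inv, Real.mul_self_sqrt hs0]; push_cast; rfl
        rw [← this]
        simp [Q]; ring
      simp only [this]
      rw [← Finset.mul_sum]
      have h2 := sum_norm_sq_cast w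
      simp only [dotProduct, Pi.star_apply] at h2
      rw [h2, ← hs, inv_mul_cancel₀]
      exact_mod_cast h0.ne'
    have hmp := (gvec_coisom Q hQ).lintegral_comp
      (f := fun z : Fin 1 → K => ENNReal.ofReal (‖z 0‖ ^ 2)) (by fun_prop)
    have hev := (measurePreserving_eval (fun _ : Fin 1 => gammaK K) 0).lintegral_comp
      (f := fun z : K => ENNReal.ofReal (‖z‖ ^ 2)) (by fun_prop)
    rw [gamma_second] at hev
    have he : ∀ h : Fin l → K, ENNReal.ofReal (‖∑ i, star (w i) * h i‖ ^ 2) =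
        ENNReal.ofReal s * ENNReal.ofReal (‖(Q *ᵥ h) 0‖ ^ 2) := by
      intro h
      rw [← ENNReal.ofReal_mul hs0]
      congr 1
      have : (Q *ᵥ h) 0 = ((√s)⁻¹ : ℝ) * ∑ i, star (w i) * h i := by
        simp [Q, Matrix.mulVec, dotProduct, Finset.mul_sum, mul_assoc]
      rw [this, norm_mul, RCLike.norm_ofReal, mul_pow, sq_abs, inv_pow, Real.sq_sqrt hs0]
      field_simp
    have hm2 : Measurable fun h : Fin l → K => ENNReal.ofReal (‖(Q *ᵥ h) 0‖ ^ 2) := by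
      have h2 := (gvec_coisom Q hQ).measurable
      fun_prop
    simp only [he]
    rw [lintegral_const_mul _ hm2, hmp]
    erw [hev]
    rw [mul_one]

lemma measurable_joint {K : Type*} [RCLike K] [MeasurableSpace K] [BorelSpace K] {r l : ℕ}
    (j : Fin r) : Measurable fun N : Fin (r + 1) → Fin l → K =>
      ENNReal.ofReal (‖∑ i, star (Wm (Matrix.of fun k => N k.succ) j i) * N 0 i‖ ^ 2) := by
  have h1 : Measurable fun N : Fin (r + 1) → Fin l → K => fun k : Fin r => N k.succ := by fun_prop
  have h2 := fun i => (measurable_Wm (K := K) (l := l) j i).comp h1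
  have h3 : ∀ i, Measurable fun N : Fin (r + 1) → Fin l → K =>
      star (Wm (Matrix.of fun k => N k.succ) j i) := fun i => continuous_star.measurable.comp (h2 i)
  fun_prop

lemma joint_int {K : Type*} [RCLike K] [MeasurableSpace K] [BorelSpace K] {r l : ℕ}
    (hr : (r : ℝ) < l - alphaK K) (j : Fin r) :
    ∫⁻ N, ENNReal.ofReal (‖∑ i, star (Wm (Matrix.of fun k => N k.succ) j i) * N 0 i‖ ^ 2)
      ∂(gmat K (Fin (r + 1)) (Fin l)) = ENNReal.ofReal (1 / (l - r - alphaK K)) := by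
  have hm := measurable_joint (K := K) (l := l) j
  have mp := mp_insert (Measure.pi fun _ : Fin l => gammaK K) r 0
  rw [gmat, ← mp.lintegral_comp hm]
  refine (lintegral_prod _ (hm.comp mp.measurable).aemeasurable).trans ?_
  rw [← Wm_int hr j]
  refine lintegral_congr fun Y' => ?_
  rw [← lin_second]
  refine lintegral_congr fun y => ?_
  have h1 : (fun k : Fin r => (Fin.insertNth (α := fun _ => Fin l → K) 0 y Y') k.succ) = Y' := by
    ext k; simp
  have h2 : (Fin.insertNth (α := fun _ => Fin l → K) 0 y Y') 0 = y := by simp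
  simp only [Function.comp_def, h1, h2]

/-- stack a unit vector on top of an isometry -/
def Qt {K : Type*} [RCLike K] {n r : ℕ} (Q : Matrix (Fin n) (Fin r) K) (q : Fin n → K) :
    Matrix (Fin (r + 1)) (Fin n) K :=
  Matrix.of (Fin.cons (α := fun _ => Fin n → K) (star q) (fun k i => star (Q i k)))

lemma Qt_coisom {K : Type*} [RCLike K] {n r : ℕ} (Q : Matrix (Fin n) (Fin r) K) (q : Fin n → K)
    (hQ : Qᴴ * Q = 1) (hq : Qᴴ *ᵥ q = 0) (hq1 : star q ⬝ᵥ q = 1) : Qt Q q * (Qt Q q)ᴴ = 1 := by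
  have hq' : ∀ k, ∑ i, star (Q i k) * q i = 0 := fun k => congrFun hq k
  have hQ' : ∀ a b, ∑ i, star (Q i a) * Q i b = (1 : Matrix (Fin r) (Fin r) K) a b :=
    fun a b => by rw [← hQ]; rfl
  ext a b
  rw [Matrix.mul_apply]
  refine Fin.cases ?_ (fun a => ?_) a <;> refine Fin.cases ?_ (fun b => ?_) b
  · simpa [Qt, dotProduct] using hq1
  · have := congrArg star (hq' b)
    simp only [star_sum, star_mul', star_star, star_zero] at this
    rw [Matrix.one_apply_ne (Fin.succ_ne_zero b).symm, ← this]
    simp [Qt, mul_comm]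
  · rw [Matrix.one_apply_ne (Fin.succ_ne_zero a), ← hq' a]
    simp [Qt]
  · have := hQ' a b
    simp only [Matrix.one_apply, Fin.succ_inj] at this ⊢
    rw [← this]
    simp [Qt]

lemma col_int {K : Type*} [RCLike K] [MeasurableSpace K] [BorelSpace K] {n r l : ℕ}
    (hr : (r : ℝ) < l - alphaK K) (Q : Matrix (Fin n) (Fin r) K) (hQ : Qᴴ * Q = 1)
    (b : Fin n → K) (hb : Qᴴ *ᵥ b = 0) (j : Fin r) :
    ∫⁻ M, ENNReal.ofReal (‖(Wm (Qᴴ * Matrix.of M) *ᵥ ((Matrix.of M)ᴴ *ᵥ b)) j‖ ^ 2)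
      ∂(gmat K (Fin n) (Fin l)) =
      ENNReal.ofReal (∑ i, ‖b i‖ ^ 2) * ENNReal.ofReal (1 / (l - r - alphaK K)) := by
  set s : ℝ := ∑ i, ‖b i‖ ^ 2 with hs
  have hs0 : 0 ≤ s := Finset.sum_nonneg fun k _ => sq_nonneg _
  rcases hs0.eq_or_lt with h0 | h0
  · have hw : b = 0 := by
      ext i
      have := (Finset.sum_eq_zero_iff_of_nonneg (fun k _ => sq_nonneg ‖b k‖)).1 h0.symm i
        (Finset.mem_univ i)
      simpa using this
    simp [hw, ← h0]
  · let q : Fin n → K := (((√s)⁻¹ : ℝ) : K) • b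
    have hss : (((√s) : ℝ) : K) * (((√s)⁻¹ : ℝ) : K) = 1 := by
      rw [← RCLike.ofReal_mul, mul_inv_cancel₀ (Real.sqrt_pos.2 h0).ne']; simp
    have hbq : b = ((√s : ℝ) : K) • q := by
      simp only [q, smul_smul, hss, one_smul]
    have hq : Qᴴ *ᵥ q = 0 := by simp [q, Matrix.mulVec_smul, hb]
    have hq1 : star q ⬝ᵥ q = 1 := by
      have h2 := sum_norm_sq_cast b
      simp only [q, star_smul, smul_dotProduct, dotProduct_smul, h2, smul_eq_mul, ← hs,
        RCLike.star_def, RCLike.conj_ofReal]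
      rw [← RCLike.ofReal_mul, ← RCLike.ofReal_mul, ← mul_assoc, ← mul_inv, Real.mul_self_sqrt hs0,
        inv_mul_cancel₀ h0.ne']
      simp
    have mp := gmat_coisom (l := Fin l) (Qt Q q) (Qt_coisom Q q hQ hq hq1)
    have hm := measurable_joint (K := K) (l := l) j
    have hJ := mp.lintegral_comp hm
    rw [joint_int hr j] at hJ
    have hm' := hm.comp mp.measurable
    simp only [Function.comp_def] at hm'
    rw [← hJ, ← lintegral_const_mul _ hm']
    refine lintegral_congr fun M => ?_
    rw [← ENNReal.ofReal_mul hs0]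
    congr 1
    have hW : (Matrix.of fun (k : Fin r) (i : Fin l) => ∑ k', Qt Q q k.succ k' * M k' i) =
        Qᴴ * Matrix.of M := by
      ext k i
      simp [Qt, Matrix.mul_apply]
    have hN : ∀ i, ∑ k', Qt Q q 0 k' * M k' i = ∑ k', star (q k') * M k' i := by
      intro i; simp [Qt]
    have he : (Wm (Qᴴ * Matrix.of M) *ᵥ ((Matrix.of M)ᴴ *ᵥ b)) j = ((√s : ℝ) : K) *
        star (∑ i, star (Wm (Qᴴ * Matrix.of M) j i) * ∑ k', star (q k') * M k' i) := by
      rw [hbq, Matrix.mulVec_smul, Matrix.mulVec_smul, Pi.smul_apply, smul_eq_mul]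
      congr 1
      simp only [Matrix.mulVec, dotProduct, star_sum, star_mul', star_star, Matrix.conjTranspose_apply,
        Matrix.of_apply]
      simp only [mul_comm]
    rw [hW]
    simp only [hN]
    rw [he, norm_mul, norm_star, mul_pow, RCLike.norm_ofReal, sq_abs, Real.sq_sqrt hs0]

lemma frobSq_nonneg {K : Type*} [RCLike K] {m n : Type*} [Fintype m] [Fintype n]
    (A : Matrix m n K) : 0 ≤ frobSq A :=
  Finset.sum_nonneg fun _ _ => Finset.sum_nonneg fun _ _ => sq_nonneg _

lemma frobSq_neg {K : Type*} [RCLike K] {m n : Type*} [Fintype m] [Fintype n]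
    (A : Matrix m n K) : frobSq (-A) = frobSq A := by
  simp [frobSq]

lemma frobSq_pyth {K : Type*} [RCLike K] {n r p : ℕ} (Q : Matrix (Fin n) (Fin r) K)
    (hQ : Qᴴ * Q = 1) (P : Matrix (Fin n) (Fin p) K) (hP : Qᴴ * P = 0) (Z : Matrix (Fin r) (Fin p) K) :
    frobSq (P - Q * Z) = frobSq P + frobSq Z := by
  have hP' : Pᴴ * Q = 0 := by
    have := congrArg Matrix.conjTranspose hP
    simpa [Matrix.conjTranspose_mul] using this
  rw [← frobSq_isom Q hQ Z, frobSq_eq_trace, frobSq_eq_trace P, frobSq_eq_trace (Q * Z)]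
  have : (P - Q * Z)ᴴ * (P - Q * Z) = Pᴴ * P + (Q * Z)ᴴ * (Q * Z) := by
    rw [Matrix.conjTranspose_sub, Matrix.sub_mul, Matrix.mul_sub, Matrix.mul_sub,
      ← Matrix.mul_assoc Pᴴ, hP', Matrix.conjTranspose_mul Q Z, Matrix.mul_assoc Zᴴ Qᴴ P, hP]
    simp
  rw [this, Matrix.trace_add, map_add]

lemma inf_frob {K : Type*} [RCLike K] {n d p r : ℕ} (A : Matrix (Fin n) (Fin d) K)
    (B : Matrix (Fin n) (Fin p) K) (Q : Matrix (Fin n) (Fin r) K) (S : Matrix (Fin d) (Fin r) K)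
    (hQ : Qᴴ * Q = 1) (hQA : Q * (Qᴴ * A) = A) (hS : Q = A * S) :
    ⨅ X : Matrix (Fin d) (Fin p) K, frobSq (B - A * X) = frobSq (B - Q * (Qᴴ * B)) := by
  have hP : Qᴴ * (B - Q * (Qᴴ * B)) = 0 := by
    rw [Matrix.mul_sub, ← Matrix.mul_assoc Qᴴ Q, hQ, Matrix.one_mul, sub_self]
  have key : ∀ X : Matrix (Fin d) (Fin p) K, frobSq (B - A * X) =
      frobSq (B - Q * (Qᴴ * B)) + frobSq (Qᴴ * A * X - Qᴴ * B) := by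
    intro X
    rw [← frobSq_pyth Q hQ _ hP]
    congr 1
    rw [Matrix.mul_sub, ← Matrix.mul_assoc Q (Qᴴ * A) X, hQA]
    abel
  apply le_antisymm
  · refine (ciInf_le ⟨0, ?_⟩ (S * (Qᴴ * B))).trans_eq ?_
    · rintro _ ⟨X, rfl⟩; exact frobSq_nonneg _
    · rw [← Matrix.mul_assoc A, ← hS]
  · refine le_ciInf fun X => ?_
    rw [key X]
    linarith [frobSq_nonneg (Qᴴ * A * X - Qᴴ * B)]

lemma det_identity {K : Type*} [RCLike K] {n d p r l : ℕ} (A : Matrix (Fin n) (Fin d) K)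
    (B : Matrix (Fin n) (Fin p) K) (Q : Matrix (Fin n) (Fin r) K) (S : Matrix (Fin d) (Fin r) K)
    (hQ : Qᴴ * Q = 1) (hQA : Q * (Qᴴ * A) = A) (hS : Q = A * S)
    (M : Matrix (Fin n) (Fin l) K) (X : Matrix (Fin d) (Fin l) K) (hX : IsMoorePenrose (Mᴴ * A) X)
    (hLI : LinearIndependent K (Qᴴ * M).row) :
    frobSq (B - A * (X * (Mᴴ * B))) = frobSq (B - Q * (Qᴴ * B)) +
      frobSq (Wm (Qᴴ * M) * (Mᴴ * (B - Q * (Qᴴ * B)))) := by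
  have hP : Qᴴ * (B - Q * (Qᴴ * B)) = 0 := by
    rw [Matrix.mul_sub, ← Matrix.mul_assoc Qᴴ Q, hQ, Matrix.one_mul, sub_self]
  set Y := Qᴴ * M with hY
  have hYH : Yᴴ = Mᴴ * Q := by rw [hY, Matrix.conjTranspose_mul, Matrix.conjTranspose_conjTranspose]
  have hdet : IsUnit (Y * Yᴴ).det := isUnit_iff_ne_zero.2 ((linInd_iff_det Y).1 hLI)
  have hWY : Wm Y * Yᴴ = 1 := by
    rw [Wm, Matrix.mul_assoc, Matrix.nonsing_inv_mul _ hdet]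
  have hN : (Mᴴ * A)ᴴ * (Mᴴ * A * X) = (Mᴴ * A)ᴴ := by
    have h := congrArg Matrix.conjTranspose hX.1
    rw [Matrix.conjTranspose_mul, hX.2.2.1] at h
    exact h
  have hSY : Sᴴ * (Mᴴ * A)ᴴ = Y := by
    rw [← Matrix.conjTranspose_mul, Matrix.mul_assoc, ← hS, ← hYH, Matrix.conjTranspose_conjTranspose]
  have hYN : Y * (Mᴴ * A * X) = Y := by
    rw [← hSY, Matrix.mul_assoc, hN]
  have hMA : Mᴴ * A = Yᴴ * (Qᴴ * A) := by
    rw [hYH, Matrix.mul_assoc, hQA]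
  have hZ : Qᴴ * A * X = Wm Y := by
    rw [hMA] at hYN
    rw [Wm]
    have : (Y * Yᴴ)⁻¹ * (Y * (Yᴴ * (Qᴴ * A) * X)) = Qᴴ * A * X := by
      rw [Matrix.mul_assoc Yᴴ, ← Matrix.mul_assoc Y Yᴴ, ← Matrix.mul_assoc _ (Y * Yᴴ),
        Matrix.nonsing_inv_mul _ hdet, Matrix.one_mul]
    rw [← this, hYN]
  have hAX : A * (X * (Mᴴ * B)) = Q * (Wm Y * (Mᴴ * B)) := by
    rw [← hZ]
    conv_lhs => rw [← hQA]
    simp only [Matrix.mul_assoc]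
  have hWB : Wm Y * (Mᴴ * (B - Q * (Qᴴ * B))) = Wm Y * (Mᴴ * B) - Qᴴ * B := by
    rw [Matrix.mul_sub, Matrix.mul_sub, ← Matrix.mul_assoc Mᴴ Q, ← hYH, ← Matrix.mul_assoc _ Yᴴ, hWY,
      Matrix.one_mul]
  rw [← frobSq_pyth Q hQ _ hP, hWB, hAX, Matrix.mul_sub]
  congr 1
  abel

lemma ae_good {K : Type*} [RCLike K] [MeasurableSpace K] [BorelSpace K] {n r l : ℕ}
    (hr : (r : ℝ) < l - alphaK K) (Q : Matrix (Fin n) (Fin r) K) (hQ : Qᴴ * Q = 1) :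
    ∀ᵐ M ∂(gmat K (Fin n) (Fin l)), LinearIndependent K (Qᴴ * Matrix.of M).row := by
  have mp := gmat_coisom (l := Fin l) Qᴴ (by rwa [Matrix.conjTranspose_conjTranspose])
  have h := ae_LI K l r hr
  exact mp.quasiMeasurePreserving.ae h

lemma measurable_term {K : Type*} [RCLike K] [MeasurableSpace K] [BorelSpace K] {n r l : ℕ}
    (Q : Matrix (Fin n) (Fin r) K) (hQ : Qᴴ * Q = 1) (b : Fin n → K) (j : Fin r) :
    Measurable fun M : Fin n → Fin l → K =>
      ‖(Wm (Qᴴ * Matrix.of M) *ᵥ ((Matrix.of M)ᴴ *ᵥ b)) j‖ ^ 2 := by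
  have mp := gmat_coisom (l := Fin l) Qᴴ (by rwa [Matrix.conjTranspose_conjTranspose])
  have h1 : ∀ i, Measurable fun M : Fin n → Fin l → K => Wm (Qᴴ * Matrix.of M) j i :=
    fun i => (measurable_Wm j i).comp mp.measurable
  have h2 : ∀ i, Measurable fun M : Fin n → Fin l → K => ((Matrix.of M)ᴴ *ᵥ b) i := by
    intro i
    have : Continuous fun M : Fin n → Fin l → K => ((Matrix.of M)ᴴ *ᵥ b) i := by
      simp only [Matrix.mulVec, dotProduct, Matrix.conjTranspose_apply, Matrix.of_apply]
      fun_prop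
    exact this.measurable
  simp only [Matrix.mulVec_eq_sum, Finset.sum_apply, Matrix.mulVec, dotProduct] at h2 ⊢
  fun_prop

lemma term_int {K : Type*} [RCLike K] [MeasurableSpace K] [BorelSpace K] {n r l : ℕ}
    (hr : (r : ℝ) < l - alphaK K) (Q : Matrix (Fin n) (Fin r) K) (hQ : Qᴴ * Q = 1)
    (b : Fin n → K) (hb : Qᴴ *ᵥ b = 0) (j : Fin r) :
    Integrable (fun M : Fin n → Fin l → K =>
      ‖(Wm (Qᴴ * Matrix.of M) *ᵥ ((Matrix.of M)ᴴ *ᵥ b)) j‖ ^ 2) (gmat K (Fin n) (Fin l)) ∧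
    ∫ M, ‖(Wm (Qᴴ * Matrix.of M) *ᵥ ((Matrix.of M)ᴴ *ᵥ b)) j‖ ^ 2 ∂(gmat K (Fin n) (Fin l)) =
      (∑ i, ‖b i‖ ^ 2) * (1 / (l - r - alphaK K)) := by
  have hm := measurable_term (l := l) Q hQ b j
  have hc := col_int hr Q hQ b hb j
  have hpos : (0 : ℝ) ≤ 1 / (l - r - alphaK K) := by
    apply one_div_nonneg.2; linarith
  have h0 : ∀ᵐ M ∂(gmat K (Fin n) (Fin l)),
      0 ≤ ‖(Wm (Qᴴ * Matrix.of M) *ᵥ ((Matrix.of M)ᴴ *ᵥ b)) j‖ ^ 2 := ae_of_all _ fun _ => sq_nonneg _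
  constructor
  · refine ⟨hm.aestronglyMeasurable, ?_⟩
    rw [hasFiniteIntegral_iff_ofReal h0, hc]
    exact ENNReal.mul_lt_top ENNReal.ofReal_lt_top ENNReal.ofReal_lt_top
  · rw [integral_eq_lintegral_of_nonneg_ae h0 hm.aestronglyMeasurable, hc, ENNReal.toReal_mul,
      ENNReal.toReal_ofReal (Finset.sum_nonneg fun _ _ => sq_nonneg _), ENNReal.toReal_ofReal hpos]

lemma main_int {K : Type*} [RCLike K] [MeasurableSpace K] [BorelSpace K] {n r l p : ℕ}
    (hr : (r : ℝ) < l - alphaK K) (Q : Matrix (Fin n) (Fin r) K) (hQ : Qᴴ * Q = 1)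
    (P : Matrix (Fin n) (Fin p) K) (hP : Qᴴ * P = 0) :
    ∫ M, (frobSq P + ∑ j, ∑ k, ‖(Wm (Qᴴ * Matrix.of M) *ᵥ ((Matrix.of M)ᴴ *ᵥ fun i => P i k)) j‖ ^ 2)
      ∂(gmat K (Fin n) (Fin l)) = (1 + r / (l - r - alphaK K)) * frobSq P := by
  have hb : ∀ k, Qᴴ *ᵥ (fun i => P i k) = 0 := by
    intro k
    ext a
    exact congrFun (congrFun hP a) k
  have ht := fun j k => term_int (l := l) hr Q hQ _ (hb k) j
  haveI := gammaK_prob K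
  rw [integral_add (integrable_const _)
    (integrable_finsetSum _ fun j _ => integrable_finsetSum _ fun k _ => (ht j k).1),
    integral_finsetSum _ fun j _ => integrable_finsetSum _ fun k _ => (ht j k).1]
  have : ∀ j, ∫ M, ∑ k, ‖(Wm (Qᴴ * Matrix.of M) *ᵥ ((Matrix.of M)ᴴ *ᵥ fun i => P i k)) j‖ ^ 2
      ∂(gmat K (Fin n) (Fin l)) = frobSq P * (1 / (l - r - alphaK K)) := by
    intro j
    rw [integral_finsetSum _ fun k _ => (ht j k).1]
    simp only [(ht j _).2]
    rw [← Finset.sum_mul, frobSq, Finset.sum_comm]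
  simp only [this]
  simp
  ring

end SketchProof


/-- **Sketch-and-solve, exact analysis for Gaussian embeddings** (Theorem 2.1):
`E‖B − AX̂‖_F² = (1 + r/(ℓ − r − α_K)) · min_X ‖B − AX‖_F²`. -/
theorem sketch_and_solve_gaussian
    {K : Type*} [RCLike K] [MeasurableSpace K] [BorelSpace K]
    {Y : Type*} [MeasurableSpace Y] (μ : Measure Y) [IsProbabilityMeasure μ]
    (pinv : (m n : ℕ) → Matrix (Fin m) (Fin n) K → Matrix (Fin n) (Fin m) K)
    (hpinv : ∀ (m n : ℕ) (A : Matrix (Fin m) (Fin n) K), IsMoorePenrose A (pinv m n A))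
    (n ℓ d p : ℕ) (hℓn : ℓ ≤ n)
    (M : Y → Matrix (Fin n) (Fin ℓ) K)
    (hM : IsGaussianEmbedding μ M)
    (A : Matrix (Fin n) (Fin d) K) (B : Matrix (Fin n) (Fin p) K)
    (hrank : (A.rank : ℝ) < (ℓ : ℝ) - alphaK K) :
    ∫ ω, frobSq (B - A * (pinv ℓ d ((M ω)ᴴ * A) * ((M ω)ᴴ * B))) ∂μ
      = (1 + (A.rank : ℝ) / ((ℓ : ℝ) - (A.rank : ℝ) - alphaK K)) *
        ⨅ X : Matrix (Fin d) (Fin p) K, frobSq (B - A * X) := by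
  classical
  obtain ⟨Q, hQ, hQA, S, hS⟩ := exists_colbasis A
  have hP : Qᴴ * (B - Q * (Qᴴ * B)) = 0 := by
    rw [Matrix.mul_sub, ← Matrix.mul_assoc Qᴴ Q, hQ, Matrix.one_mul, sub_self]
  rw [inf_frob A B Q S hQ hQA hS, ← main_int hrank Q hQ _ hP]
  obtain ⟨hMm, hMl⟩ := hM
  rw [gaussianMatrix_eq] at hMl
  have hMm' : @Measurable Y (Fin n → Fin ℓ → K) _ _ M := hMm
  have hMl' : @Measure.map Y (Fin n → Fin ℓ → K) _ _ M μ = gmat K (Fin n) (Fin ℓ) := hMl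
  have hmeas : Measurable fun N : Fin n → Fin ℓ → K => (frobSq (B - Q * (Qᴴ * B)) +
      ∑ j, ∑ k, ‖(Wm (Qᴴ * Matrix.of N) *ᵥ
        ((Matrix.of N)ᴴ *ᵥ fun i => (B - Q * (Qᴴ * B)) i k)) j‖ ^ 2) := by
    have := fun j k => measurable_term (l := ℓ) Q hQ (fun i => (B - Q * (Qᴴ * B)) i k) j
    exact measurable_const.add
      (Finset.measurable_fun_sum _ fun j _ => Finset.measurable_fun_sum _ fun k _ => this j k)
  rw [← hMl', integral_map hMm'.aemeasurable hmeas.aestronglyMeasurable]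
  have hg := ae_good (l := ℓ) hrank Q hQ
  rw [← hMl'] at hg
  refine integral_congr_ae ?_
  filter_upwards [ae_of_ae_map hMm'.aemeasurable hg] with ω hω
  exact det_identity A B Q S hQ hQA hS (M ω) _ (hpinv _ _ _) hω
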